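/- arXiv:1312.2184 — 2 statements merged into one kernel-verified Lean document; each statement's English description precedes it below -/
import Mathlib

section
/- Let N₁ ≥ 1 be an integer, let Ω₁ be a bounded open subset of ℝ^{N₁} with 0 ∈ Ω₁, let γ > 0, let 0 < m ≤ M, and let b : ℝ^{N₁} → ℝ be continuous with m ≤ b(x) ≤ M for all x in the closure of Ω₁. For μ > 0 define λ(μ) as the infimum, over all nonzero smooth compactly supported functions v : ℝ^{N₁} → ℝ with support contained in Ω₁, of the Rayleigh quotient (∫_{Ω₁} (|∇v(x)|² + μ |x|^{2γ} b(x) v(x)²) dx) / (∫_{Ω₁} v(x)² dx). Then there exist constants c_* > 0 and c^* > 0 such that for every μ ≥ 1, c_* · μ^{1/(1+γ)} ≤ λ(μ) ≤ c^* · μ^{1/(1+γ)}. -/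
open MeasureTheory

section Auxiliary

variable {E : Type*} [NormedAddCommGroup E]

theorem energy_integrand_continuous [NormedSpace ℝ E] {v : E → ℝ} (hv : ContDiff ℝ 1 v)
    {γ : ℝ} (hγ : 0 ≤ γ) {b : E → ℝ} (hb : Continuous b) (μ : ℝ) :
    Continuous fun x => ‖fderiv ℝ v x‖ ^ 2 + μ * ‖x‖ ^ (2 * γ) * b x * (v x) ^ 2 := by
  have h1 : Continuous fun x : E => ‖x‖ ^ (2 * γ) :=
    continuous_norm.rpow_const fun _ => Or.inr (by positivity)
  have h2 := hv.continuous
  have h3 := hv.continuous_fderiv one_ne_zero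
  fun_prop

theorem energy_integrand_integrable [NormedSpace ℝ E] [MeasurableSpace E] [BorelSpace E]
    (ν : Measure E) [IsFiniteMeasureOnCompacts ν]
    {v : E → ℝ} (hv : ContDiff ℝ 1 v) (hc : HasCompactSupport v)
    {γ : ℝ} (hγ : 0 ≤ γ) {b : E → ℝ} (hb : Continuous b) (μ : ℝ) :
    Integrable (fun x => ‖fderiv ℝ v x‖ ^ 2 + μ * ‖x‖ ^ (2 * γ) * b x * (v x) ^ 2) ν := by
  refine (energy_integrand_continuous hv hγ hb μ).integrable_of_hasCompactSupport
    (hc.mono' fun x hx => ?_)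
  by_contra hxv
  exact hx (by simp [fderiv_of_notMem_tsupport ℝ hxv, image_eq_zero_of_notMem_tsupport hxv])

theorem sq_integrable [MeasurableSpace E] [BorelSpace E]
    (ν : Measure E) [IsFiniteMeasureOnCompacts ν]
    {v : E → ℝ} (hv : Continuous v) (hc : HasCompactSupport v) :
    Integrable (fun x => (v x) ^ 2) ν := by
  refine (hv.pow 2).integrable_of_hasCompactSupport (hc.mono' fun x hx => ?_)
  exact subset_tsupport _ fun h => hx (by simp [h])

theorem integral_fderiv_apply_eq_zero [NormedSpace ℝ E] [FiniteDimensional ℝ E]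
    [MeasurableSpace E] [BorelSpace E] (ν : Measure E) [ν.IsAddHaarMeasure]
    {g : E → ℝ} (hg : ContDiff ℝ 1 g) (hc : HasCompactSupport g) (e : E) :
    ∫ x, fderiv ℝ g x e ∂ν = 0 := by
  have hcont : Continuous fun x => fderiv ℝ g x e :=
    (hg.continuous_fderiv one_ne_zero).clm_apply continuous_const
  have h := integral_mul_fderiv_eq_neg_fderiv_mul_of_integrable (μ := ν) (𝕜 := ℝ)
    (f := fun _ => (1 : ℝ)) (g := g) (v := e) (by simp)
    (by simpa using hcont.integrable_of_hasCompactSupport (hc.fderiv_apply ℝ e))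
    (by simpa using hg.continuous.integrable_of_hasCompactSupport hc)
    (fun _ _ => by fun_prop) (fun x _ => (hg.differentiable one_ne_zero) x)
  simpa using h

theorem quarter_le_cos_sub_sin_sq_add_rpow {m γ a s r : ℝ} (hm : 0 < m) (hγ : 0 ≤ γ)
    (ha : 0 < a) (ha1 : a ≤ 1 / 4) (ham : a ≤ m / 4) (hs : |s| ≤ r) :
    a / 4 ≤ a * Real.cos s - (a * Real.sin s) ^ 2 + m * r ^ (2 * γ) := by
  have hr : 0 ≤ r := (abs_nonneg s).trans hs
  have hsin : (a * Real.sin s) ^ 2 ≤ a ^ 2 := by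
    rw [mul_pow]
    nlinarith [Real.sin_sq_le_one s, sq_nonneg a]
  have ha2 : a ^ 2 ≤ a / 4 := by nlinarith
  rcases le_total r 1 with h | h
  · have h1 : s ^ 2 ≤ 1 := by
      rw [← sq_abs]; nlinarith [abs_nonneg s]
    have hcos : 1 / 2 ≤ Real.cos s := by
      linarith [Real.one_sub_sq_div_two_le_cos (x := s)]
    have h2 : 0 ≤ m * r ^ (2 * γ) := by positivity
    nlinarith
  · have h2 : 1 ≤ r ^ (2 * γ) := Real.one_le_rpow h (by positivity)
    nlinarith [Real.neg_one_le_cos s]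

theorem sq_integral_le_energy [InnerProductSpace ℝ E] [FiniteDimensional ℝ E]
    [MeasurableSpace E] [BorelSpace E] (ν : Measure E) [ν.IsAddHaarMeasure]
    {e : E} (he : ‖e‖ = 1) {m γ a t : ℝ} (hm : 0 < m) (hγ : 0 ≤ γ)
    (ha : 0 < a) (ha1 : a ≤ 1 / 4) (ham : a ≤ m / 4) (ht : 0 < t)
    {v : E → ℝ} (hv : ContDiff ℝ 1 v) (hc : HasCompactSupport v) {F : E → ℝ}
    (hF : Integrable F ν)
    (hle : ∀ x, ‖fderiv ℝ v x‖ ^ 2 + m * t ^ 2 * ‖t • x‖ ^ (2 * γ) * (v x) ^ 2 ≤ F x) :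
    a / 4 * t ^ 2 * ∫ x, (v x) ^ 2 ∂ν ≤ ∫ x, F x ∂ν := by
  set g : E → ℝ := fun x => a * t * Real.sin (t * inner ℝ e x) * (v x) ^ 2 with hg_def
  have hg : ContDiff ℝ 1 g := by
    have h1 : ContDiff ℝ 1 fun x : E => inner ℝ e x := contDiff_const.inner ℝ contDiff_id
    simp only [hg_def]
    fun_prop
  have hgc : HasCompactSupport g := hc.mono' fun x hx =>
    subset_tsupport _ fun h => hx (by simp [hg_def, h])
  have hfd : ∀ x, fderiv ℝ g x e = a * t ^ 2 * Real.cos (t * inner ℝ e x) * (v x) ^ 2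
      + 2 * (a * t * Real.sin (t * inner ℝ e x)) * v x * fderiv ℝ v x e := by
    intro x
    have h1 : HasFDerivAt (fun y : E => t * inner ℝ e y) (t • innerSL ℝ e) x :=
      ((innerSL ℝ e).hasFDerivAt).const_mul t
    have h2 := (hv.differentiable one_ne_zero x).hasFDerivAt
    have h3 := (h1.sin.const_mul (a * t)).mul (h2.pow 2)
    rw [show g = _ from rfl, HasFDerivAt.fderiv (f := g) h3]
    simp [he]
    ring
  have hint := integral_fderiv_apply_eq_zero ν hg hgc e
  have hgi : Integrable (fun x => fderiv ℝ g x e) ν :=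
    ((hg.continuous_fderiv one_ne_zero).clm_apply
      continuous_const).integrable_of_hasCompactSupport (hgc.fderiv_apply ℝ e)
  have hsq := (sq_integrable ν hv.continuous hc).const_mul (a / 4 * t ^ 2)
  have hpt : ∀ x, a / 4 * t ^ 2 * (v x) ^ 2 - fderiv ℝ g x e ≤ F x := by
    intro x
    refine le_trans ?_ (hle x)
    rw [hfd]
    have hs : |t * inner ℝ e x| ≤ ‖t • x‖ := by
      rw [abs_mul, norm_smul, Real.norm_eq_abs]
      gcongr
      simpa [he] using abs_real_inner_le_norm e x
    have hq := mul_le_mul_of_nonneg_right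
      (quarter_le_cos_sub_sin_sq_add_rpow hm hγ ha ha1 ham hs)
      (by positivity : 0 ≤ t ^ 2 * (v x) ^ 2)
    have hd : (fderiv ℝ v x e) ^ 2 ≤ ‖fderiv ℝ v x‖ ^ 2 := by
      rw [← sq_abs, ← Real.norm_eq_abs]
      gcongr
      simpa [he] using (fderiv ℝ v x).le_opNorm e
    nlinarith [sq_nonneg (fderiv ℝ v x e + a * t * Real.sin (t * inner ℝ e x) * v x)]
  calc a / 4 * t ^ 2 * ∫ x, (v x) ^ 2 ∂ν
      = ∫ x, (a / 4 * t ^ 2 * (v x) ^ 2 - fderiv ℝ g x e) ∂ν := by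
        rw [integral_sub hsq hgi, hint, integral_const_mul, sub_zero]
    _ ≤ ∫ x, F x ∂ν := integral_mono (hsq.sub hgi) hF hpt

theorem mul_rpow_eq_sq_mul_rpow_norm_smul [NormedSpace ℝ E] {μ γ : ℝ} (hμ : 0 < μ) (hγ : 0 < γ)
    (x : E) :
    μ * ‖x‖ ^ (2 * γ) = (μ ^ (1 / (2 * (1 + γ)))) ^ 2 *
      ‖μ ^ (1 / (2 * (1 + γ))) • x‖ ^ (2 * γ) := by
  rw [norm_smul, Real.norm_of_nonneg (by positivity),
    Real.mul_rpow (by positivity) (norm_nonneg x), ← mul_assoc, ← Real.rpow_natCast,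
    ← Real.rpow_mul hμ.le, ← Real.rpow_mul hμ.le, ← Real.rpow_add hμ]
  have : 1 / (2 * (1 + γ)) * ((2 : ℕ) : ℝ) + 1 / (2 * (1 + γ)) * (2 * γ) = 1 := by
    push_cast
    field_simp
  rw [this, Real.rpow_one]

end Auxiliary

/-- Two-sided bound `c_* μ^{1/(1+γ)} ≤ λ(μ) ≤ c^* μ^{1/(1+γ)}` for the first Dirichlet
eigenvalue of `−Δ + μ |x|^{2γ} b(x)` on `Ω₁`, expressed via its variational (Rayleigh
quotient) characterization over smooth compactly supported test functions. -/
theorem first_eigenvalue_two_sided_bound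
    (N₁ : ℕ) (hN₁ : 1 ≤ N₁)
    (Ω₁ : Set (EuclideanSpace ℝ (Fin N₁)))
    (hΩ₁o : IsOpen Ω₁) (hΩ₁b : Bornology.IsBounded Ω₁)
    (h0 : (0 : EuclideanSpace ℝ (Fin N₁)) ∈ Ω₁)
    (γ : ℝ) (hγ : 0 < γ)
    (m M : ℝ) (hm : 0 < m) (hmM : m ≤ M)
    (b : EuclideanSpace ℝ (Fin N₁) → ℝ) (hb : Continuous b)
    (hbm : ∀ x ∈ closure Ω₁, m ≤ b x) (hbM : ∀ x ∈ closure Ω₁, b x ≤ M)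
    (lam : ℝ → ℝ)
    (hlam : ∀ μ : ℝ, 0 < μ →
      lam μ = sInf { R : ℝ | ∃ v : EuclideanSpace ℝ (Fin N₁) → ℝ,
        ContDiff ℝ (⊤ : ℕ∞) v ∧ HasCompactSupport v ∧ tsupport v ⊆ Ω₁ ∧ v ≠ 0 ∧
        R = (∫ x in Ω₁, (‖fderiv ℝ v x‖ ^ 2 + μ * ‖x‖ ^ (2 * γ) * b x * (v x) ^ 2)) /
            (∫ x in Ω₁, (v x) ^ 2) }) :
    ∃ cStar cSup : ℝ, 0 < cStar ∧ 0 < cSup ∧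
      ∀ μ : ℝ, 1 ≤ μ →
        cStar * μ ^ (1 / (1 + γ)) ≤ lam μ ∧ lam μ ≤ cSup * μ ^ (1 / (1 + γ)) := by
  have hn : 0 < N₁ := hN₁
  have hsq : ∀ μ : ℝ, 0 < μ → (μ ^ (1 / (2 * (1 + γ)))) ^ 2 = μ ^ (1 / (1 + γ)) := by
    intro μ hμ
    rw [← Real.rpow_natCast, ← Real.rpow_mul hμ.le]
    congr 1
    push_cast
    field_simp
  have hΩsq : ∀ v : EuclideanSpace ℝ (Fin N₁) → ℝ, tsupport v ⊆ Ω₁ →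
      ∫ x in Ω₁, (v x) ^ 2 = ∫ x, (v x) ^ 2 :=
    fun v hs => setIntegral_eq_integral_of_forall_compl_eq_zero fun x hx => by
      simp [image_eq_zero_of_notMem_tsupport fun h => hx (hs h)]
  have hΩen : ∀ (v : EuclideanSpace ℝ (Fin N₁) → ℝ) (μ : ℝ), tsupport v ⊆ Ω₁ →
      ∫ x in Ω₁, (‖fderiv ℝ v x‖ ^ 2 + μ * ‖x‖ ^ (2 * γ) * b x * (v x) ^ 2) =
      ∫ x, (‖fderiv ℝ v x‖ ^ 2 + μ * ‖x‖ ^ (2 * γ) * b x * (v x) ^ 2) :=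
    fun v μ hs => setIntegral_eq_integral_of_forall_compl_eq_zero fun x hx => by
      simp [image_eq_zero_of_notMem_tsupport fun h => hx (hs h),
        fderiv_of_notMem_tsupport ℝ fun h => hx (hs h)]
  have hpos : ∀ v : EuclideanSpace ℝ (Fin N₁) → ℝ, Continuous v → HasCompactSupport v → v ≠ 0 →
      0 < ∫ x, (v x) ^ 2 := by
    intro v hv hc h
    obtain ⟨x, hx⟩ := Function.ne_iff.mp h
    exact (hv.pow 2).integral_pos_of_hasCompactSupport_nonneg_nonzero
      (hc.mono' fun x hx => subset_tsupport _ fun h => hx (by simp [h]))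
      (fun x => sq_nonneg _) (x := x) (pow_ne_zero 2 hx)
  -- A fixed bump function, whose rescalings give the upper bound.
  obtain ⟨ρ, hρ, hball⟩ := Metric.isOpen_iff.mp hΩ₁o 0 h0
  let f : ContDiffBump (0 : EuclideanSpace ℝ (Fin N₁)) :=
    ⟨ρ / 4, ρ / 2, by positivity, by linarith⟩
  have hf : ContDiff ℝ (⊤ : ℕ∞) (f : EuclideanSpace ℝ (Fin N₁) → ℝ) := f.contDiff
  have hf1 : ContDiff ℝ 1 (f : EuclideanSpace ℝ (Fin N₁) → ℝ) := f.contDiff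
  have hf0 : (f : EuclideanSpace ℝ (Fin N₁) → ℝ) 0 = 1 :=
    f.one_of_mem_closedBall (by simp [f]; positivity)
  set A := ∫ x, (‖fderiv ℝ f x‖ ^ 2 + 1 * ‖x‖ ^ (2 * γ) * M * (f x) ^ 2) with hA
  set B := ∫ x, (f x) ^ 2 with hB
  have hBpos : 0 < B := hpos f f.continuous f.hasCompactSupport fun h => by simp [h] at hf0
  have hM : 0 < M := hm.trans_le hmM
  have hA0 : 0 ≤ A := integral_nonneg fun x => by positivity
  set a := min 1 m / 4 with ha
  have hapos : 0 < a := by positivity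
  have ha1 : a ≤ 1 / 4 := by linarith [min_le_left 1 m]
  have ham : a ≤ m / 4 := by linarith [min_le_right 1 m]
  refine ⟨a / 4, (A + 1) / B, by positivity, by positivity, fun μ hμ => ?_⟩
  have hμ0 : 0 < μ := by linarith
  rw [hlam μ hμ0, ← hsq μ hμ0]
  set t := μ ^ (1 / (2 * (1 + γ))) with ht
  have ht1 : 1 ≤ t := Real.one_le_rpow hμ (by positivity)
  have ht0 : 0 < t := by linarith
  have hscale : ∀ x : EuclideanSpace ℝ (Fin N₁), μ * ‖x‖ ^ (2 * γ) = t ^ 2 * ‖t • x‖ ^ (2 * γ) :=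
    fun x => mul_rpow_eq_sq_mul_rpow_norm_smul hμ0 hγ x
  have hlow : ∀ R ∈ { R : ℝ | ∃ v : EuclideanSpace ℝ (Fin N₁) → ℝ,
        ContDiff ℝ (⊤ : ℕ∞) v ∧ HasCompactSupport v ∧ tsupport v ⊆ Ω₁ ∧ v ≠ 0 ∧
        R = (∫ x in Ω₁, (‖fderiv ℝ v x‖ ^ 2 + μ * ‖x‖ ^ (2 * γ) * b x * (v x) ^ 2)) /
            (∫ x in Ω₁, (v x) ^ 2) }, a / 4 * t ^ 2 ≤ R := by
    rintro R ⟨v, hv, hc, hs, hv0, rfl⟩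
    have hv1 : ContDiff ℝ 1 v := hv.of_le (by exact_mod_cast le_top)
    rw [hΩsq v hs, hΩen v μ hs, le_div_iff₀ (hpos v hv.continuous hc hv0)]
    refine sq_integral_le_energy volume (e := EuclideanSpace.single ⟨0, hn⟩ (1 : ℝ)) (by simp)
      hm hγ.le hapos ha1 ham ht0 hv1 hc
      (energy_integrand_integrable volume hv1 hc hγ.le hb μ) fun x => ?_
    by_cases hx : x ∈ tsupport v
    · rw [hscale]
      have h1 := hbm x (subset_closure (hs hx))
      have h2 : m * (t ^ 2 * ‖t • x‖ ^ (2 * γ) * (v x) ^ 2) ≤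
          b x * (t ^ 2 * ‖t • x‖ ^ (2 * γ) * (v x) ^ 2) := by gcongr
      linarith
    · simp [image_eq_zero_of_notMem_tsupport hx]
  set w : EuclideanSpace ℝ (Fin N₁) → ℝ := fun x => f (t • x) with hw
  have hwd : ContDiff ℝ (⊤ : ℕ∞) w := hf.comp (contDiff_const_smul t)
  have hwd1 : ContDiff ℝ 1 w := hf1.comp (contDiff_const_smul t)
  have hwc : HasCompactSupport w := f.hasCompactSupport.comp_smul ht0.ne'
  have hws : tsupport w ⊆ Ω₁ := by
    refine (closure_minimal (t := Metric.closedBall 0 (ρ / 2)) (fun x hx => ?_)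
      Metric.isClosed_closedBall).trans
      ((Metric.closedBall_subset_ball (half_lt_self hρ)).trans hball)
    have h1 : t • x ∈ Function.support f := hx
    rw [f.support_eq, mem_ball_zero_iff, norm_smul, Real.norm_of_nonneg ht0.le] at h1
    rw [mem_closedBall_zero_iff]
    have h2 : f.rOut = ρ / 2 := rfl
    nlinarith [norm_nonneg x]
  have hw0 : w ≠ 0 := fun h => by
    have := congrFun h 0
    simp [hw, hf0] at this
  have hmem : (∫ x in Ω₁, (‖fderiv ℝ w x‖ ^ 2 + μ * ‖x‖ ^ (2 * γ) * b x * (w x) ^ 2)) /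
      (∫ x in Ω₁, (w x) ^ 2) ∈ { R : ℝ | ∃ v : EuclideanSpace ℝ (Fin N₁) → ℝ,
        ContDiff ℝ (⊤ : ℕ∞) v ∧ HasCompactSupport v ∧ tsupport v ⊆ Ω₁ ∧ v ≠ 0 ∧
        R = (∫ x in Ω₁, (‖fderiv ℝ v x‖ ^ 2 + μ * ‖x‖ ^ (2 * γ) * b x * (v x) ^ 2)) /
            (∫ x in Ω₁, (v x) ^ 2) } := ⟨w, hwd, hwc, hws, hw0, rfl⟩
  refine ⟨le_csInf ⟨_, hmem⟩ hlow, (csInf_le ⟨_, hlow⟩ hmem).trans ?_⟩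
  rw [hΩsq w hws, hΩen w μ hws, div_le_iff₀ (hpos w hwd.continuous hwc hw0)]
  set J := |(t ^ Module.finrank ℝ (EuclideanSpace ℝ (Fin N₁)))⁻¹| with hJ
  have hwB : ∫ x, (w x) ^ 2 = J * B :=
    Measure.integral_comp_smul volume (fun x : EuclideanSpace ℝ (Fin N₁) => (f x) ^ 2) t
  have hcomp : Integrable (fun x : EuclideanSpace ℝ (Fin N₁) => t ^ 2 * (‖fderiv ℝ f (t • x)‖ ^ 2
      + 1 * ‖t • x‖ ^ (2 * γ) * M * (f (t • x)) ^ 2)) :=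
    ((energy_integrand_integrable volume hf1 f.hasCompactSupport hγ.le
      (continuous_const (y := M)) 1).comp_smul ht0.ne').const_mul _
  have hwA : ∫ x, (‖fderiv ℝ w x‖ ^ 2 + μ * ‖x‖ ^ (2 * γ) * b x * (w x) ^ 2) ≤
      t ^ 2 * (J * A) := by
    rw [hA, hJ, ← smul_eq_mul (|_|), ← Measure.integral_comp_smul volume
      (fun x : EuclideanSpace ℝ (Fin N₁) => ‖fderiv ℝ f x‖ ^ 2 + 1 * ‖x‖ ^ (2 * γ) * M * (f x) ^ 2) t,
      ← integral_const_mul]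
    refine integral_mono (energy_integrand_integrable volume hwd1 hwc hγ.le hb μ) hcomp
      fun x => ?_
    have hfd : ‖fderiv ℝ w x‖ = t * ‖fderiv ℝ f (t • x)‖ := by
      rw [hw, fderiv_comp_smul, norm_smul, Real.norm_of_nonneg ht0.le]
    by_cases hx : x ∈ tsupport w
    · have h1 := hbM x (subset_closure (hws hx))
      have h2 : b x * (t ^ 2 * ‖t • x‖ ^ (2 * γ) * (w x) ^ 2) ≤
          M * (t ^ 2 * ‖t • x‖ ^ (2 * γ) * (w x) ^ 2) := by gcongr
      simp only [hfd, hscale, mul_pow]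
      simp only [hw] at h2 ⊢
      linarith
    · simp only [fderiv_of_notMem_tsupport ℝ hx, image_eq_zero_of_notMem_tsupport hx]
      simp only [norm_zero, ne_eq, OfNat.ofNat_ne_zero, not_false_eq_true, zero_pow, mul_zero,
        add_zero]
      positivity
  have hJ0 : 0 ≤ J := abs_nonneg _
  calc _ ≤ t ^ 2 * (J * A) := hwA
    _ ≤ t ^ 2 * (J * (A + 1)) := by gcongr; linarith
    _ = (A + 1) / B * t ^ 2 * ∫ x, (w x) ^ 2 := by
      rw [hwB]
      field_simp
end

section
/- Let N₁ ≥ 1 be an integer, let Ω₁ be a bounded open subset of ℝ^{N₁} with 0 ∈ Ω₁, let γ > 0 and M > 0. There exists a constant c^* > 0 such that for every μ ≥ 1 there exists a nonzero smooth compactly supported function v : ℝ^{N₁} → ℝ with support contained in Ω₁ satisfying ∫_{Ω₁} (|∇v(x)|² + μ M |x|^{2γ} v(x)²) dx ≤ c^* · μ^{1/(1+γ)} · ∫_{Ω₁} v(x)² dx. -/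
open MeasureTheory

section Dilation

variable {E : Type*} [NormedAddCommGroup E] [NormedSpace ℝ E]

lemma fderiv_comp_const_smul_apply {φ : E → ℝ} (hφ : Differentiable ℝ φ) (s : ℝ) (x : E) :
    fderiv ℝ (fun y ↦ φ (s • y)) x = s • fderiv ℝ φ (s • x) := by
  have h := (hφ (s • x)).hasFDerivAt.comp x ((hasFDerivAt_id x).const_smul s)
  refine h.fderiv.trans ?_
  ext y
  simp

/-- Dilating by `s` with `s ^ (2 * (1 + γ)) = μ` makes both terms of the energy density scale
like `s ^ 2`. -/
lemma energy_density_comp_smul {φ : E → ℝ} (hφ : Differentiable ℝ φ) {s γ : ℝ} (hs : 0 < s)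
    (M : ℝ) (x : E) :
    ‖fderiv ℝ (fun y ↦ φ (s • y)) x‖ ^ 2
        + s ^ (2 * (1 + γ)) * M * ‖x‖ ^ (2 * γ) * φ (s • x) ^ 2 =
      s ^ 2 * (‖fderiv ℝ φ (s • x)‖ ^ 2 + M * ‖s • x‖ ^ (2 * γ) * φ (s • x) ^ 2) := by
  rw [fderiv_comp_const_smul_apply hφ, norm_smul, norm_smul, Real.norm_of_nonneg hs.le,
    Real.mul_rpow hs.le (norm_nonneg x), mul_add 2 1 γ, mul_one, Real.rpow_add hs,
    Real.rpow_two]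
  ring

lemma tsupport_comp_smul_subset_closedBall {φ : E → ℝ} {r s : ℝ} (hs : 1 ≤ s)
    (hφ : tsupport φ ⊆ Metric.closedBall 0 r) :
    tsupport (fun x ↦ φ (s • x)) ⊆ Metric.closedBall 0 r := by
  refine closure_minimal (fun x hx ↦ ?_) Metric.isClosed_closedBall
  have h := hφ (subset_tsupport φ (show s • x ∈ Function.support φ from hx))
  rw [mem_closedBall_zero_iff, norm_smul, Real.norm_of_nonneg (by linarith)] at h
  rw [mem_closedBall_zero_iff]
  nlinarith [norm_nonneg x]

end Dilation

/-- Trial-function (upper-bound) half of the eigenvalue asymptotics: for every `μ ≥ 1`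
there is a nonzero smooth test function `v` supported in `Ω₁` whose Rayleigh quotient for
`−Δ + μ M |x|^{2γ}` is at most `c^* μ^{1/(1+γ)}`. -/
theorem first_eigenvalue_upper_bound
    (N₁ : ℕ) (hN₁ : 1 ≤ N₁)
    (Ω₁ : Set (EuclideanSpace ℝ (Fin N₁)))
    (hΩ₁o : IsOpen Ω₁) (hΩ₁b : Bornology.IsBounded Ω₁)
    (h0 : (0 : EuclideanSpace ℝ (Fin N₁)) ∈ Ω₁)
    (γ : ℝ) (hγ : 0 < γ) (M : ℝ) (hM : 0 < M) :
    ∃ cSup : ℝ, 0 < cSup ∧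
      ∀ μ : ℝ, 1 ≤ μ →
        ∃ v : EuclideanSpace ℝ (Fin N₁) → ℝ,
          ContDiff ℝ (⊤ : ℕ∞) v ∧ HasCompactSupport v ∧ tsupport v ⊆ Ω₁ ∧ v ≠ 0 ∧
          (∫ x in Ω₁, (‖fderiv ℝ v x‖ ^ 2 + μ * M * ‖x‖ ^ (2 * γ) * (v x) ^ 2)) ≤
            cSup * μ ^ (1 / (1 + γ)) * (∫ x in Ω₁, (v x) ^ 2) := by
  obtain ⟨r, hr, hrΩ⟩ := Metric.nhds_basis_closedBall.mem_iff.1 (hΩ₁o.mem_nhds h0)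
  let φ : ContDiffBump (0 : EuclideanSpace ℝ (Fin N₁)) := ⟨r / 2, r, by linarith, by linarith⟩
  have hφ : ContDiff ℝ (⊤ : ℕ∞) φ := φ.contDiff
  have hφ1 : φ 0 = 1 := φ.one_of_mem_closedBall (by simp [φ.rIn_pos.le])
  have hφd : Differentiable ℝ φ := hφ.differentiable (by simp)
  set I := ∫ x, ‖fderiv ℝ φ x‖ ^ 2 + M * ‖x‖ ^ (2 * γ) * φ x ^ 2 with hI
  set J := ∫ x, φ x ^ 2 with hJ
  have hI0 : 0 ≤ I := integral_nonneg fun x ↦ by positivity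
  have hJ0 : 0 < J := by
    refine Continuous.integral_pos_of_hasCompactSupport_nonneg_nonzero (x := 0)
      (φ.continuous.pow 2) ?_ (fun x ↦ sq_nonneg _) (by simp [hφ1])
    exact φ.hasCompactSupport.comp_left (g := fun t : ℝ ↦ t ^ 2) (by simp)
  refine ⟨I / J + 1, by positivity, fun μ hμ ↦ ?_⟩
  have hμ0 : 0 < μ := by linarith
  set s := μ ^ (1 / (2 * (1 + γ))) with hs
  have hs1 : 1 ≤ s := Real.one_le_rpow hμ (by positivity)
  have hs0 : 0 < s := by linarith
  have hsμ : s ^ (2 * (1 + γ)) = μ := by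
    rw [hs, ← Real.rpow_mul hμ0.le, one_div_mul_cancel (by positivity), Real.rpow_one]
  have hs2 : μ ^ (1 / (1 + γ)) = s ^ 2 := by
    rw [hs, ← Real.rpow_two, ← Real.rpow_mul hμ0.le]
    congr 1
    field_simp
  have hsupp : tsupport (fun x ↦ φ (s • x)) ⊆ Metric.closedBall 0 r :=
    tsupport_comp_smul_subset_closedBall hs1 φ.tsupport_eq.subset
  have hv0 : ∀ x ∉ Ω₁, φ (s • x) = 0 := fun x hx ↦
    image_eq_zero_of_notMem_tsupport (f := fun x ↦ φ (s • x)) fun h ↦ hx (hrΩ (hsupp h))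
  have hdv0 : ∀ x ∉ Ω₁, fderiv ℝ (fun x ↦ φ (s • x)) x = 0 := fun x hx ↦
    fderiv_of_notMem_tsupport (𝕜 := ℝ) fun h ↦ hx (hrΩ (hsupp h))
  refine ⟨fun x ↦ φ (s • x), hφ.comp (contDiff_id.const_smul s),
    HasCompactSupport.of_support_subset_isCompact (isCompact_closedBall 0 r)
      ((subset_tsupport _).trans hsupp), hsupp.trans hrΩ,
    fun h ↦ by simpa [hφ1] using congrFun h 0, ?_⟩
  rw [setIntegral_eq_integral_of_forall_compl_eq_zero fun x hx ↦ by simp [hv0 x hx, hdv0 x hx],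
    setIntegral_eq_integral_of_forall_compl_eq_zero fun x hx ↦ by simp [hv0 x hx], hs2]
  nth_rewrite 1 [← hsμ]
  simp_rw [energy_density_comp_smul hφd hs0]
  rw [integral_const_mul,
    Measure.integral_comp_smul volume
      (fun x ↦ ‖fderiv ℝ φ x‖ ^ 2 + M * ‖x‖ ^ (2 * γ) * φ x ^ 2) s,
    Measure.integral_comp_smul volume (fun x ↦ φ x ^ 2) s, ← hI, ← hJ, smul_eq_mul, smul_eq_mul]
  set c := |(s ^ Module.finrank ℝ (EuclideanSpace ℝ (Fin N₁)))⁻¹|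
  have hIJ : I ≤ (I / J + 1) * J := by
    rw [add_mul, div_mul_cancel₀ _ hJ0.ne']
    linarith
  calc s ^ 2 * (c * I) ≤ s ^ 2 * (c * ((I / J + 1) * J)) := by gcongr
    _ = (I / J + 1) * s ^ 2 * (c * J) := by ring
end
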